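/- For every β ∈ ℝ and t ∈ (0,1], lim_{n→∞} E[⟨R_{1,2}(σ1,σ2)²⟩_{β, g, g_t}] = 0, where the expectation is over the coupled SK disorders (g, g_t) and ⟨·⟩_{β,g,g_t} is the coupled Gibbs average with σ1 ~ μ_{β,g} and σ2 ~ μ_{β,g_t} independent. -/

import Mathlib

open MeasureTheory ProbabilityTheory Filter

noncomputable section

/-- The value of a ±1 spin encoded as a Boolean. -/
def spin (b : Bool) : ℝ := if b then 1 else -1

/-- The Ising Hamiltonian `H(σ; X) = ∑_{i,j} X i j σ(i) σ(j)`. -/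
def Ham {n : ℕ} (X : Fin n → Fin n → ℝ) (σ : Fin n → Bool) : ℝ :=
  ∑ i, ∑ j, X i j * spin (σ i) * spin (σ j)

/-- The partition function `Z(β, X)`. -/
def Zpart {n : ℕ} (β : ℝ) (X : Fin n → Fin n → ℝ) : ℝ :=
  ∑ σ : Fin n → Bool, Real.exp (-β * Ham X σ)

/-- The Gibbs probability mass function `μ_{β,X}(σ)`. -/
def gibbs {n : ℕ} (β : ℝ) (X : Fin n → Fin n → ℝ) (σ : Fin n → Bool) : ℝ :=
  Real.exp (-β * Ham X σ) / Zpart β X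

/-- A configuration is a bisection if `|∑ i σ(i)| ≤ 1`. -/
def isBis {n : ℕ} (σ : Fin n → Bool) : Prop := |∑ i, spin (σ i)| ≤ 1

open scoped Classical in
/-- The bisection partition function `Z^bis(β, X)`. -/
def ZpartBis {n : ℕ} (β : ℝ) (X : Fin n → Fin n → ℝ) : ℝ :=
  ∑ σ : Fin n → Bool, if isBis σ then Real.exp (-β * Ham X σ) else 0

open scoped Classical in
/-- The bisection Gibbs probability mass function `μ^bis_{β,X}(σ)`. -/
def gibbsBis {n : ℕ} (β : ℝ) (X : Fin n → Fin n → ℝ) (σ : Fin n → Bool) : ℝ :=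
  if isBis σ then Real.exp (-β * Ham X σ) / ZpartBis β X else 0

/-- The overlap `R_{1,2}(σ1, σ2) = (1/n) ∑ i σ1(i) σ2(i)`. -/
def overlap {n : ℕ} (σ1 σ2 : Fin n → Bool) : ℝ :=
  (1 / (n : ℝ)) * ∑ i, spin (σ1 i) * spin (σ2 i)

/-- Gibbs average of a one-variable observable. -/
def avg1 {n : ℕ} (β : ℝ) (X : Fin n → Fin n → ℝ) (f : (Fin n → Bool) → ℝ) : ℝ :=
  ∑ σ : Fin n → Bool, f σ * gibbs β X σ

/-- Bisection Gibbs average of a one-variable observable. -/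
def avg1Bis {n : ℕ} (β : ℝ) (X : Fin n → Fin n → ℝ) (f : (Fin n → Bool) → ℝ) : ℝ :=
  ∑ σ : Fin n → Bool, f σ * gibbsBis β X σ

/-- Coupled Gibbs average: `σ1 ~ μ_{β,X}`, `σ2 ~ μ_{β,Y}` independent. -/
def avg2c {n : ℕ} (β : ℝ) (X Y : Fin n → Fin n → ℝ)
    (f : (Fin n → Bool) → (Fin n → Bool) → ℝ) : ℝ :=
  ∑ σ1 : Fin n → Bool, ∑ σ2 : Fin n → Bool, f σ1 σ2 * gibbs β X σ1 * gibbs β Y σ2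

/-- Gibbs average of a two-replica observable. -/
def avg2 {n : ℕ} (β : ℝ) (X : Fin n → Fin n → ℝ)
    (f : (Fin n → Bool) → (Fin n → Bool) → ℝ) : ℝ :=
  avg2c β X X f

/-- Coupled bisection Gibbs average. -/
def avg2cBis {n : ℕ} (β : ℝ) (X Y : Fin n → Fin n → ℝ)
    (f : (Fin n → Bool) → (Fin n → Bool) → ℝ) : ℝ :=
  ∑ σ1 : Fin n → Bool, ∑ σ2 : Fin n → Bool, f σ1 σ2 * gibbsBis β X σ1 * gibbsBis β Y σ2

/-- Bisection Gibbs average of a two-replica observable. -/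
def avg2Bis {n : ℕ} (β : ℝ) (X : Fin n → Fin n → ℝ)
    (f : (Fin n → Bool) → (Fin n → Bool) → ℝ) : ℝ :=
  avg2cBis β X X f

/-- The SK disorder: i.i.d. entries `N(0, 1/(2n))`. -/
def skMeasure (n : ℕ) : Measure (Fin n → Fin n → ℝ) :=
  Measure.pi fun _ => Measure.pi fun _ => gaussianReal 0 (1 / (2 * n))

/-- The law of the pair `(g, g')` of independent SK disorders. -/
def skPair (n : ℕ) : Measure ((Fin n → Fin n → ℝ) × (Fin n → Fin n → ℝ)) :=
  (skMeasure n).prod (skMeasure n)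

/-- The perturbed SK disorder `g_t = √(1-t) g + √t g'`. -/
def skPerturb {n : ℕ} (t : ℝ) (g g' : Fin n → Fin n → ℝ) : Fin n → Fin n → ℝ :=
  fun i j => Real.sqrt (1 - t) * g i j + Real.sqrt t * g' i j

/-- The sparse disorder: i.i.d. entries `Poisson(d/(2n))`. -/
def sparseMeasure (n : ℕ) (d : ℝ) : Measure (Fin n → Fin n → ℕ) :=
  Measure.pi fun _ => Measure.pi fun _ => poissonMeasure (d / (2 * n)).toNNReal

/-- The law of the triple `(A^{(1-t)}, A^{(t,1)}, A^{(t,2)})` of independent sparse disorders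
used to build the coupled pair `A = A^{(1-t)} + A^{(t,1)}`, `A_t = A^{(1-t)} + A^{(t,2)}`. -/
def coupledSparse (n : ℕ) (d t : ℝ) :
    Measure ((Fin n → Fin n → ℕ) × (Fin n → Fin n → ℕ) × (Fin n → Fin n → ℕ)) :=
  (sparseMeasure n ((1 - t) * d)).prod
    ((sparseMeasure n (t * d)).prod (sparseMeasure n (t * d)))

/-- View an ℕ-valued matrix as a real matrix. -/
def natMat {n : ℕ} (A : Fin n → Fin n → ℕ) : Fin n → Fin n → ℝ := fun i j => (A i j : ℝ)

/-- The Gibbs measure `μ_{β,X}` as a probability measure on configurations. -/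
def gibbsMeasure {n : ℕ} (β : ℝ) (X : Fin n → Fin n → ℝ) : Measure (Fin n → Bool) :=
  ∑ σ : Fin n → Bool, ENNReal.ofReal (gibbs β X σ) • Measure.dirac σ

/-- The bisection Gibbs measure `μ^bis_{β,X}` as a measure on configurations. -/
def gibbsBisMeasure {n : ℕ} (β : ℝ) (X : Fin n → Fin n → ℝ) : Measure (Fin n → Bool) :=
  ∑ σ : Fin n → Bool, ENNReal.ofReal (gibbsBis β X σ) • Measure.dirac σ

/-- Normalized Wasserstein distance `W_{2,n}` between measures on `{-1,1}^n`. -/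
def W2 (n : ℕ) (μ1 μ2 : Measure (Fin n → Bool)) : ℝ :=
  sInf {r : ℝ | ∃ π : Measure ((Fin n → Bool) × (Fin n → Bool)),
    IsProbabilityMeasure π ∧ π.map Prod.fst = μ1 ∧ π.map Prod.snd = μ2 ∧
    r = Real.sqrt (∫ p, (1 / (n : ℝ)) * ∑ i, (spin (p.1 i) - spin (p.2 i)) ^ 2 ∂π)}

open scoped Classical in
/-- Overlap-restricted coupled partition function `Z^S_{X,Y}`. -/
def Zres {n : ℕ} (β : ℝ) (S : Set ℝ) (X Y : Fin n → Fin n → ℝ) : ℝ :=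
  ∑ σ1 : Fin n → Bool, ∑ σ2 : Fin n → Bool,
    if overlap σ1 σ2 ∈ S then Real.exp (-β * (Ham X σ1 + Ham Y σ2)) else 0

open scoped Classical in
/-- Overlap-restricted coupled bisection partition function `Z^{S,bis}_{X,Y}`. -/
def ZresBis {n : ℕ} (β : ℝ) (S : Set ℝ) (X Y : Fin n → Fin n → ℝ) : ℝ :=
  ∑ σ1 : Fin n → Bool, ∑ σ2 : Fin n → Bool,
    if isBis σ1 ∧ isBis σ2 ∧ overlap σ1 σ2 ∈ S
    then Real.exp (-β * (Ham X σ1 + Ham Y σ2)) else 0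

/-- The matrix with a single `1` in position `(i,j)`. -/
def Jmat {n : ℕ} (i j : Fin n) : Fin n → Fin n → ℝ :=
  fun a b => if a = i ∧ b = j then 1 else 0

end

/-- The orthogonal reflection `(x, y) ↦ (s x + c y, c x - s y)` of a pair of vectors. -/
def reflPair {E : Type*} [AddCommGroup E] [Module ℝ E] (s c : ℝ) (p : E × E) : E × E :=
  (s • p.1 + c • p.2, c • p.1 - s • p.2)

theorem reflPair_reflPair {E : Type*} [AddCommGroup E] [Module ℝ E] {s c : ℝ}
    (h : s ^ 2 + c ^ 2 = 1) (p : E × E) : reflPair s c (reflPair s c p) = p := by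
  have h' : s * s + c * c = 1 := by rw [← h]; ring
  ext1
  · calc s • (s • p.1 + c • p.2) + c • (c • p.1 - s • p.2) = (s * s + c * c) • p.1 := by module
      _ = p.1 := by rw [h', one_smul]
  · calc c • (s • p.1 + c • p.2) - s • (c • p.1 - s • p.2) = (s * s + c * c) • p.2 := by module
      _ = p.2 := by rw [h', one_smul]

theorem measurePreserving_reflPair_gaussianReal (v : NNReal) {s c : ℝ} (h : s ^ 2 + c ^ 2 = 1) :
    MeasurePreserving (reflPair s c)
      ((gaussianReal 0 v).prod (gaussianReal 0 v)) ((gaussianReal 0 v).prod (gaussianReal 0 v)) := by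
  obtain ⟨θ, hs, hc⟩ : ∃ θ : ℝ, s = Real.cos θ ∧ c = Real.sin θ := by
    have hn : ‖(⟨s, c⟩ : ℂ)‖ = 1 := by
      rw [Complex.norm_def, Complex.normSq_mk, ← pow_two, ← pow_two, h, Real.sqrt_one]
    have h0 : (⟨s, c⟩ : ℂ) ≠ 0 := by rw [← norm_ne_zero_iff, hn]; norm_num
    refine ⟨Complex.arg ⟨s, c⟩, ?_, ?_⟩
    · rw [Complex.cos_arg h0, hn]; simp
    · rw [Complex.sin_arg, hn]; simp
  have hrot : MeasurePreserving (ContinuousLinearMap.rotation θ)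
      ((gaussianReal 0 v).prod (gaussianReal 0 v)) ((gaussianReal 0 v).prod (gaussianReal 0 v)) :=
    ⟨(ContinuousLinearMap.rotation θ).continuous.measurable,
      IsGaussian.map_rotation_eq_self (by simp) θ⟩
  have hneg : MeasurePreserving (fun x : ℝ => -x) (gaussianReal 0 v) (gaussianReal 0 v) :=
    ⟨measurable_neg, by rw [gaussianReal_map_neg, neg_zero]⟩
  convert ((MeasurePreserving.id (gaussianReal 0 v)).prod hneg).comp hrot using 1
  ext p
  · simp [reflPair, hs, hc, ContinuousLinearMap.rotation_apply]
  · simp [reflPair, hs, hc, ContinuousLinearMap.rotation_apply]; ring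

theorem measurePreserving_reflPair_pi {ι E : Type*} [Fintype ι] [AddCommGroup E] [Module ℝ E]
    [MeasurableSpace E] (μ : Measure E) [SigmaFinite μ] {s c : ℝ}
    (h : MeasurePreserving (reflPair (E := E) s c) (μ.prod μ) (μ.prod μ)) :
    MeasurePreserving (reflPair (E := ι → E) s c)
      ((Measure.pi fun _ : ι => μ).prod (Measure.pi fun _ : ι => μ))
      ((Measure.pi fun _ : ι => μ).prod (Measure.pi fun _ : ι => μ)) := by
  have h1 := measurePreserving_arrowProdEquivProdArrow E E ι (fun _ => μ) (fun _ => μ)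
  have h2 := measurePreserving_pi (fun _ : ι => μ.prod μ) (fun _ => μ.prod μ) (fun _ => h)
  exact (h1.comp h2).comp h1.symm

instance (n : ℕ) : IsProbabilityMeasure (skMeasure n) := by
  unfold skMeasure; infer_instance

instance (n : ℕ) : IsProbabilityMeasure (skPair n) := by
  unfold skPair; infer_instance

theorem measurePreserving_reflPair_skPair (n : ℕ) {s c : ℝ} (h : s ^ 2 + c ^ 2 = 1) :
    MeasurePreserving (reflPair s c) (skPair n) (skPair n) :=
  measurePreserving_reflPair_pi _
    (measurePreserving_reflPair_pi _ (measurePreserving_reflPair_gaussianReal _ h))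

theorem integral_reflPair_skPair {n : ℕ} {s c : ℝ} (h : s ^ 2 + c ^ 2 = 1)
    (F : (Fin n → Fin n → ℝ) × (Fin n → Fin n → ℝ) → ℝ) :
    ∫ p, F (reflPair s c p) ∂(skPair n) = ∫ p, F p ∂(skPair n) := by
  have hm := measurePreserving_reflPair_skPair n h
  refine hm.integral_comp ?_ F
  exact (MeasurableEquiv.mk (Equiv.mk _ _ (reflPair_reflPair h) (reflPair_reflPair h))
    hm.measurable hm.measurable).measurableEmbedding

/-- Gaussian integration by parts in one dimension. -/
theorem integral_mul_id_gaussianReal (v : NNReal) {f f' : ℝ → ℝ}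
    (hf : ∀ x, HasDerivAt f (f' x) x) (hf'm : Measurable f') {A B : ℝ}
    (hA : ∀ x, |f x| ≤ A) (hB : ∀ x, |f' x| ≤ B) :
    ∫ x, f x * x ∂(gaussianReal 0 v) = v * ∫ x, f' x ∂(gaussianReal 0 v) := by
  rcases eq_or_ne v 0 with rfl | hv
  · simp [gaussianReal_zero_var]
  have hfm : Measurable f :=
    (continuous_iff_continuousAt.2 fun x => (hf x).continuousAt).measurable
  have hid : Integrable (fun x : ℝ => x) (gaussianReal 0 v) :=
    memLp_one_iff_integrable.1 (by simpa using! memLp_id_gaussianReal (μ := 0) (v := v) 1)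
  have hint : ∀ {g : ℝ → ℝ}, Integrable g (gaussianReal 0 v) →
      Integrable (fun x => g x * gaussianPDFReal 0 v x) := by
    intro g hg
    rw [gaussianReal_of_var_ne_zero _ hv, integrable_withDensity_iff (measurable_gaussianPDF _ _)
      (ae_of_all _ fun _ ↦ gaussianPDF_lt_top)] at hg
    simpa using hg
  have h1 : Integrable f (gaussianReal 0 v) :=
    Integrable.of_bound hfm.aestronglyMeasurable A (ae_of_all _ hA)
  have h2 : Integrable f' (gaussianReal 0 v) :=
    Integrable.of_bound hf'm.aestronglyMeasurable B (ae_of_all _ hB)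
  have h3 : Integrable (fun x => f x * x) (gaussianReal 0 v) :=
    hid.bdd_mul hfm.aestronglyMeasurable (ae_of_all _ hA)
  have hpdf : ∀ x, HasDerivAt (gaussianPDFReal 0 v) (-(x / v) * gaussianPDFReal 0 v x) x := by
    intro x
    rw [gaussianPDFReal_def]
    have hv' : (v : ℝ) ≠ 0 := by exact_mod_cast hv
    have := (((((hasDerivAt_id x).sub_const 0).pow 2).neg.div_const (2 * (v : ℝ))).exp).const_mul
      (√(2 * Real.pi * v))⁻¹
    refine this.congr_deriv ?_
    simp
    field_simp
  have key := integral_mul_deriv_eq_deriv_mul_of_integrable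
    (u := f) (v := gaussianPDFReal 0 v) (u' := f')
    (fun x _ => hf x) (fun x _ => hpdf x) ?_ (hint h2) (hint h1)
  · rw [integral_gaussianReal_eq_integral_smul hv, integral_gaussianReal_eq_integral_smul hv]
    have hv' : (v : ℝ) ≠ 0 := by exact_mod_cast hv
    have e1 : ∫ x, gaussianPDFReal 0 v x • (f x * x)
        = -v * ∫ x, f x * (-(x / v) * gaussianPDFReal 0 v x) := by
      rw [← integral_const_mul]
      congr 1; ext x
      simp only [smul_eq_mul]; field_simp
    rw [e1, key]
    simp only [smul_eq_mul, mul_comm (gaussianPDFReal 0 v _)]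
    ring
  · refine ((hint h3).const_mul (-(v : ℝ)⁻¹)).congr (ae_of_all _ fun x => ?_)
    simp only [Pi.mul_apply]
    ring

/-- Resampling one coordinate of a product measure leaves it unchanged. -/
theorem measurePreserving_update_pi {ι : Type*} [Fintype ι] [DecidableEq ι] {E : Type*}
    [MeasurableSpace E] (μ : Measure E) [IsProbabilityMeasure μ] (i : ι) :
    MeasurePreserving (fun p : (ι → E) × E => Function.update p.1 i p.2)
      ((Measure.pi fun _ => μ).prod μ) (Measure.pi fun _ => μ) := by
  have hm : Measurable (fun p : (ι → E) × E => Function.update p.1 i p.2) := by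
    refine measurable_pi_iff.2 fun j => ?_
    by_cases hj : j = i
    · subst hj; simpa using measurable_snd
    · simp only [Function.update_of_ne hj]; fun_prop
  refine ⟨hm, (Measure.pi_eq fun s hs => ?_).symm⟩
  rw [Measure.map_apply hm (MeasurableSet.univ_pi hs)]
  have : (fun p : (ι → E) × E => Function.update p.1 i p.2) ⁻¹' (Set.univ.pi s)
      = (Set.univ.pi (Function.update s i Set.univ)) ×ˢ (s i) := by
    ext p
    simp only [Set.mem_preimage, Set.mem_univ_pi, Set.mem_prod]
    constructor
    · intro h
      refine ⟨fun j => ?_, by simpa using h i⟩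
      by_cases hj : j = i
      · subst hj; simp
      · simpa [Function.update_of_ne hj] using h j
    · rintro ⟨h, h'⟩ j
      by_cases hj : j = i
      · subst hj; simpa using h'
      · simpa [Function.update_of_ne hj] using h j
  rw [this, Measure.prod_prod, Measure.pi_pi, ← Finset.mul_prod_erase _ _ (Finset.mem_univ i),
    ← Finset.mul_prod_erase _ (fun j => μ (s j)) (Finset.mem_univ i)]
  simp only [Function.update_self, measure_univ, one_mul]
  rw [mul_comm]
  congr 1
  refine Finset.prod_congr rfl fun j hj => ?_
  rw [Function.update_of_ne (Finset.ne_of_mem_erase hj)]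

theorem integrable_entry_skMeasure {n : ℕ} (i j : Fin n) :
    Integrable (fun z : Fin n → Fin n → ℝ => z i j) (skMeasure n) := by
  set γ : Measure ℝ := gaussianReal 0 (1 / (2 * n)) with hγ
  have hid : Integrable (fun x : ℝ => x) γ :=
    memLp_one_iff_integrable.1 (by simpa using! memLp_id_gaussianReal (μ := 0) 1)
  have h1 : MeasurePreserving (fun z : Fin n → Fin n → ℝ => z i) (skMeasure n)
      (Measure.pi fun _ => γ) := measurePreserving_eval (fun _ => Measure.pi fun _ => γ) i
  exact ((measurePreserving_eval (fun _ => γ) j).comp h1).integrable_comp_of_integrable hid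

/-- Gaussian integration by parts in one entry of the SK disorder. -/
theorem integral_mul_entry_skMeasure {n : ℕ} (i j : Fin n) {k k' : (Fin n → Fin n → ℝ) → ℝ}
    (hkm : Measurable k) (hkm' : Measurable k') {A B : ℝ} (hA : ∀ x, |k x| ≤ A)
    (hB : ∀ x, |k' x| ≤ B)
    (hd : ∀ (z : Fin n → Fin n → ℝ) (w : Fin n → ℝ) (s : ℝ),
      HasDerivAt (fun s => k (Function.update z i (Function.update w j s)))
        (k' (Function.update z i (Function.update w j s))) s) :
    Integrable (fun z => k z * z i j) (skMeasure n) ∧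
    ∫ z, k z * z i j ∂(skMeasure n) = 1 / (2 * n) * ∫ z, k' z ∂(skMeasure n) := by
  set γ : Measure ℝ := gaussianReal 0 (1 / (2 * n)) with hγ
  set γn : Measure (Fin n → ℝ) := Measure.pi fun _ => γ
  have hT : MeasurePreserving
      (fun p : ((Fin n → Fin n → ℝ) × (Fin n → ℝ)) × ℝ =>
        Function.update p.1.1 i (Function.update p.1.2 j p.2))
      (((skMeasure n).prod γn).prod γ) (skMeasure n) := by
    have h1 := measurePreserving_update_pi (ι := Fin n) γ j
    have h2 := measurePreserving_update_pi (ι := Fin n) γn i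
    have h3 := ((MeasurePreserving.id (skMeasure n)).prod h1)
    exact (h2.comp h3).comp (measurePreserving_prodAssoc _ _ _)
  have hint : Integrable (fun z => k z * z i j) (skMeasure n) :=
    (integrable_entry_skMeasure i j).bdd_mul hkm.aestronglyMeasurable (ae_of_all _ hA)
  have hint' : Integrable k' (skMeasure n) :=
    Integrable.of_bound hkm'.aestronglyMeasurable B (ae_of_all _ hB)
  refine ⟨hint, ?_⟩
  have hfub : ∀ F : (Fin n → Fin n → ℝ) → ℝ, Integrable F (skMeasure n) →
      ∫ z, F z ∂(skMeasure n) = ∫ p : (Fin n → Fin n → ℝ) × (Fin n → ℝ),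
        ∫ s, F (Function.update p.1 i (Function.update p.2 j s)) ∂γ ∂((skMeasure n).prod γn) := by
    intro F hF
    have h := integral_map (f := F) hT.measurable.aemeasurable (by rw [hT.map_eq]; exact hF.1)
    rw [hT.map_eq] at h
    rw [h]
    exact integral_prod _ (hT.integrable_comp_of_integrable hF)
  rw [hfub _ hint, hfub _ hint', ← integral_const_mul]
  congr 1
  funext p
  have hm : Measurable fun s : ℝ => Function.update p.1 i (Function.update p.2 j s) :=
    measurable_update _ |>.comp (measurable_update _)
  have := integral_mul_id_gaussianReal (1 / (2 * n)) (hd p.1 p.2) (hkm'.comp hm)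
    (fun s => hA _) (fun s => hB _)
  simp only [Function.update_self]
  rw [hγ, this]
  norm_num

theorem spin_mul_self (b : Bool) : spin b * spin b = 1 := by cases b <;> simp [spin]

theorem abs_spin (b : Bool) : |spin b| = 1 := by cases b <;> simp [spin]

section Gibbs

variable {n : ℕ} (β : ℝ) (X : Fin n → Fin n → ℝ) (σ : Fin n → Bool)

theorem Zpart_pos : 0 < Zpart β X :=
  Finset.sum_pos (fun _ _ => Real.exp_pos _) Finset.univ_nonempty

theorem gibbs_nonneg : 0 ≤ gibbs β X σ :=
  div_nonneg (Real.exp_pos _).le (Zpart_pos β X).le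

theorem sum_gibbs : ∑ σ, gibbs β X σ = 1 := by
  simp only [gibbs, ← Finset.sum_div]
  exact div_self (Zpart_pos β X).ne'

theorem gibbs_le_one : gibbs β X σ ≤ 1 := by
  rw [← sum_gibbs β X]
  exact Finset.single_le_sum (fun τ _ => gibbs_nonneg β X τ) (Finset.mem_univ σ)

theorem abs_gibbs_le_one : |gibbs β X σ| ≤ 1 := by
  rw [abs_of_nonneg (gibbs_nonneg β X σ)]
  exact gibbs_le_one β X σ

theorem continuous_gibbs : Continuous fun X : Fin n → Fin n → ℝ => gibbs β X σ := by
  unfold gibbs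
  refine Continuous.div ?_ ?_ fun X => (Zpart_pos β X).ne'
  · unfold Ham; fun_prop
  · unfold Zpart Ham; fun_prop

theorem abs_Ham_le : |Ham X σ| ≤ ∑ i, ∑ j, |X i j| := by
  refine (Finset.abs_sum_le_sum_abs _ _).trans (Finset.sum_le_sum fun i _ => ?_)
  refine (Finset.abs_sum_le_sum_abs _ _).trans (Finset.sum_le_sum fun j _ => ?_)
  rw [abs_mul, abs_mul, abs_spin, abs_spin, mul_one, mul_one]

theorem Ham_Jmat (i j : Fin n) : Ham (Jmat i j) σ = spin (σ i) * spin (σ j) := by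
  unfold Ham Jmat
  rw [Finset.sum_eq_single i, Finset.sum_eq_single j]
  · simp
  · intro b _ hb; simp [hb]
  · simp
  · intro a _ ha; simp [ha]
  · simp

theorem Ham_eq_sum_Jmat : Ham X σ = ∑ i, ∑ j, X i j * Ham (Jmat i j) σ := by
  simp only [Ham_Jmat, ← mul_assoc]
  rfl

/-- The directional derivative of the Gibbs weight `μ_{β,X}(σ)` in the direction `W`. -/
noncomputable def gibbsDeriv (W : Fin n → Fin n → ℝ) : ℝ :=
  -β * gibbs β X σ * (Ham W σ - ∑ τ, gibbs β X τ * Ham W τ)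

theorem gibbsDeriv_eq_sum_Jmat (W : Fin n → Fin n → ℝ) :
    gibbsDeriv β X σ W = ∑ i, ∑ j, W i j * gibbsDeriv β X σ (Jmat i j) := by
  have h : ∑ τ, gibbs β X τ * Ham W τ
      = ∑ i, ∑ j, W i j * ∑ τ, gibbs β X τ * Ham (Jmat i j) τ := by
    simp only [Finset.mul_sum]
    rw [Finset.sum_congr rfl fun τ _ => by rw [Ham_eq_sum_Jmat W τ, Finset.mul_sum],
      Finset.sum_comm]
    refine Finset.sum_congr rfl fun i _ => ?_
    rw [Finset.sum_congr rfl fun τ _ => Finset.mul_sum _ _ _, Finset.sum_comm]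
    refine Finset.sum_congr rfl fun j _ => Finset.sum_congr rfl fun τ _ => ?_
    ring
  unfold gibbsDeriv
  rw [h, Ham_eq_sum_Jmat W σ, ← Finset.sum_sub_distrib, Finset.mul_sum]
  refine Finset.sum_congr rfl fun i _ => ?_
  rw [← Finset.sum_sub_distrib, Finset.mul_sum]
  refine Finset.sum_congr rfl fun j _ => ?_
  ring

theorem continuous_gibbs_comp {E : Type*} [TopologicalSpace E] {f : E → Fin n → Fin n → ℝ}
    (hf : Continuous f) : Continuous fun p => gibbs β (f p) σ :=
  (continuous_gibbs β σ).comp hf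

theorem continuous_gibbsDeriv_comp {E : Type*} [TopologicalSpace E] {f g : E → Fin n → Fin n → ℝ}
    (hf : Continuous f) (hg : Continuous g) : Continuous fun p => gibbsDeriv β (f p) σ (g p) := by
  have h : ∀ τ : Fin n → Bool, Continuous fun p => gibbs β (f p) τ :=
    fun τ => continuous_gibbs_comp β τ hf
  unfold gibbsDeriv Ham
  fun_prop

theorem abs_gibbsDeriv_le (W : Fin n → Fin n → ℝ) :
    |gibbsDeriv β X σ W| ≤ 2 * |β| * ∑ i, ∑ j, |W i j| := by
  have h1 : |∑ τ, gibbs β X τ * Ham W τ| ≤ ∑ i, ∑ j, |W i j| := by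
    calc |∑ τ, gibbs β X τ * Ham W τ| ≤ ∑ τ, gibbs β X τ * ∑ i, ∑ j, |W i j| := by
          refine (Finset.abs_sum_le_sum_abs _ _).trans (Finset.sum_le_sum fun τ _ => ?_)
          rw [abs_mul, abs_of_nonneg (gibbs_nonneg β X τ)]
          exact mul_le_mul_of_nonneg_left (abs_Ham_le W τ) (gibbs_nonneg β X τ)
      _ = _ := by rw [← Finset.sum_mul, sum_gibbs, one_mul]
  have h2 := abs_sub (Ham W σ) (∑ τ, gibbs β X τ * Ham W τ)
  have h3 := abs_Ham_le W σ
  have h4 := abs_gibbs_le_one β X σ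
  rw [gibbsDeriv, abs_mul, abs_mul, abs_neg]
  calc |β| * |gibbs β X σ| * |Ham W σ - ∑ τ, gibbs β X τ * Ham W τ|
      ≤ |β| * 1 * (∑ i, ∑ j, |W i j| + ∑ i, ∑ j, |W i j|) := by
        gcongr
        linarith
    _ = _ := by ring

theorem hasDerivAt_gibbs_comp {c : ℝ → Fin n → Fin n → ℝ} {c' : Fin n → Fin n → ℝ} {s : ℝ}
    (hc : ∀ i j, HasDerivAt (fun s => c s i j) (c' i j) s) :
    HasDerivAt (fun s => gibbs β (c s) σ) (gibbsDeriv β (c s) σ c') s := by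
  have hH : ∀ τ, HasDerivAt (fun s => Real.exp (-β * Ham (c s) τ))
      (Real.exp (-β * Ham (c s) τ) * (-β * Ham c' τ)) s := by
    intro τ
    refine (HasDerivAt.const_mul (-β) ?_).exp
    unfold Ham
    exact HasDerivAt.fun_sum fun i _ => HasDerivAt.fun_sum fun j _ =>
      ((hc i j).mul_const _).mul_const _
  have hZ : HasDerivAt (fun s => Zpart β (c s))
      (∑ τ, Real.exp (-β * Ham (c s) τ) * (-β * Ham c' τ)) s :=
    HasDerivAt.fun_sum fun τ _ => hH τ
  refine ((hH σ).div hZ (Zpart_pos β (c s)).ne').congr_deriv ?_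
  have hne := (Zpart_pos β (c s)).ne'
  have e : ∑ τ, Real.exp (-β * Ham (c s) τ) * (-β * Ham c' τ)
      = -β * Zpart β (c s) * ∑ τ, gibbs β (c s) τ * Ham c' τ := by
    rw [Finset.mul_sum]
    refine Finset.sum_congr rfl fun τ _ => ?_
    rw [gibbs]; field_simp
  rw [e, gibbsDeriv, gibbs]
  field_simp
  ring

end Gibbs

/-- The expected coupled Gibbs weight `E[μ_{β,g}(σ1) μ_{β,s g + c g'}(σ2)]`. -/
noncomputable def coupledWeight {n : ℕ} (β s c : ℝ) (σ1 σ2 : Fin n → Bool) : ℝ :=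
  ∫ p, gibbs β p.1 σ1 * gibbs β (s • p.1 + c • p.2) σ2 ∂(skPair n)

theorem integral_gibbs_mul_entry {n : ℕ} (β s c : ℝ) (σ : Fin n → Bool)
    (y : Fin n → Fin n → ℝ) (i j : Fin n) :
    Integrable (fun z => gibbs β (s • y + c • z) σ * z i j) (skMeasure n) ∧
    ∫ z, gibbs β (s • y + c • z) σ * z i j ∂(skMeasure n)
      = 1 / (2 * n) * ∫ z, c * gibbsDeriv β (s • y + c • z) σ (Jmat i j) ∂(skMeasure n) := by
  refine integral_mul_entry_skMeasure i j (A := 1)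
    (B := |c| * (2 * |β| * ∑ a, ∑ b, |Jmat i j a b|)) ?_ ?_ (fun z => abs_gibbs_le_one _ _ _) ?_ ?_
  · exact (continuous_gibbs_comp β σ (by fun_prop)).measurable
  · exact (continuous_const.mul
      (continuous_gibbsDeriv_comp β σ (by fun_prop) continuous_const)).measurable
  · intro z
    rw [abs_mul]
    exact mul_le_mul_of_nonneg_left (abs_gibbsDeriv_le _ _ _ _) (abs_nonneg _)
  · intro z w r
    have h := hasDerivAt_gibbs_comp β σ
      (c := fun r => s • y + c • Function.update z i (Function.update w j r))
      (c' := c • Jmat i j) (s := r) ?_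
    · refine h.congr_deriv ?_
      rw [gibbsDeriv_eq_sum_Jmat, gibbsDeriv_eq_sum_Jmat _ _ _ (Jmat i j), Finset.mul_sum]
      refine Finset.sum_congr rfl fun a _ => ?_
      rw [Finset.mul_sum]
      refine Finset.sum_congr rfl fun b _ => ?_
      simp [mul_assoc]
    · intro a b
      simp only [Pi.add_apply, Pi.smul_apply, smul_eq_mul]
      refine HasDerivAt.const_add _ (HasDerivAt.const_mul _ ?_)
      by_cases ha : a = i
      · subst ha
        by_cases hb : b = j
        · subst hb
          simpa [Jmat] using! hasDerivAt_id r
        · simpa [Jmat, hb] using! hasDerivAt_const r (w b)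
      · simpa [Jmat, ha] using! hasDerivAt_const r (z a b)

theorem hasDerivAt_coupledWeight_direction {n : ℕ} (β θ : ℝ) (σ1 σ2 : Fin n → Bool) :
    HasDerivAt (fun θ => coupledWeight β (Real.sin θ) (Real.cos θ) σ1 σ2)
      (∫ p, gibbs β p.1 σ1 * gibbsDeriv β (Real.sin θ • p.1 + Real.cos θ • p.2) σ2
        (Real.cos θ • p.1 - Real.sin θ • p.2) ∂(skPair n)) θ := by
  have hfst : MeasurePreserving Prod.fst (skPair n) (skMeasure n) := measurePreserving_fst
  have hsnd : MeasurePreserving Prod.snd (skPair n) (skMeasure n) := measurePreserving_snd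
  let F : ℝ → (Fin n → Fin n → ℝ) × (Fin n → Fin n → ℝ) → ℝ := fun θ p =>
    gibbs β p.1 σ1 * gibbs β (Real.sin θ • p.1 + Real.cos θ • p.2) σ2
  let F' : ℝ → (Fin n → Fin n → ℝ) × (Fin n → Fin n → ℝ) → ℝ := fun θ p =>
    gibbs β p.1 σ1 * gibbsDeriv β (Real.sin θ • p.1 + Real.cos θ • p.2) σ2
      (Real.cos θ • p.1 - Real.sin θ • p.2)
  have hFc : ∀ x, Continuous (F x) := fun x =>
    (continuous_gibbs_comp β σ1 continuous_fst).mul (continuous_gibbs_comp β σ2 (by fun_prop))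
  have hFc' : Continuous (F' θ) :=
    (continuous_gibbs_comp β σ1 continuous_fst).mul
      (continuous_gibbsDeriv_comp β σ2 (by fun_prop) (by fun_prop))
  have key := hasDerivAt_integral_of_dominated_loc_of_deriv_le (μ := skPair n)
    (s := Set.univ) (x₀ := θ) (F := F) (F' := F')
    (bound := fun p => 2 * |β| * ∑ i, ∑ j, (|p.1 i j| + |p.2 i j|)) Filter.univ_mem
    (Eventually.of_forall fun x => (hFc x).aestronglyMeasurable) ?_ hFc'.aestronglyMeasurable
    ?_ ?_ ?_
  · exact key.2
  · refine Integrable.of_bound (hFc θ).aestronglyMeasurable 1 (ae_of_all _ fun p => ?_)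
    rw [norm_mul]
    exact mul_le_one₀ (abs_gibbs_le_one _ _ _) (norm_nonneg _) (abs_gibbs_le_one _ _ _)
  · refine ae_of_all _ fun p x _ => ?_
    rw [norm_mul]
    refine (mul_le_of_le_one_left (norm_nonneg _) (abs_gibbs_le_one _ _ _)).trans ?_
    refine (abs_gibbsDeriv_le _ _ _ _).trans ?_
    gcongr with i _ j _
    simp only [Pi.sub_apply, Pi.smul_apply, smul_eq_mul]
    refine (abs_sub _ _).trans (add_le_add ?_ ?_) <;> rw [abs_mul]
    · exact mul_le_of_le_one_left (abs_nonneg _) (Real.abs_cos_le_one _)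
    · exact mul_le_of_le_one_left (abs_nonneg _) (Real.abs_sin_le_one _)
  · refine Integrable.const_mul (integrable_finsetSum _ fun i _ =>
      integrable_finsetSum _ fun j _ => Integrable.add ?_ ?_) _
    · exact (hfst.integrable_comp_of_integrable (integrable_entry_skMeasure i j)).abs
    · exact (hsnd.integrable_comp_of_integrable (integrable_entry_skMeasure i j)).abs
  · refine ae_of_all _ fun p x _ => HasDerivAt.const_mul _ (hasDerivAt_gibbs_comp β σ2 ?_)
    intro i j
    simp only [Pi.add_apply, Pi.sub_apply, Pi.smul_apply, smul_eq_mul]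
    refine (((Real.hasDerivAt_sin x).mul_const _).add
      ((Real.hasDerivAt_cos x).mul_const _)).congr_deriv ?_
    ring

/-- Gaussian interpolation: the derivative of the coupled weight along a rotation. -/
theorem hasDerivAt_coupledWeight {n : ℕ} (β θ : ℝ) (σ1 σ2 : Fin n → Bool) :
    HasDerivAt (fun θ => coupledWeight β (Real.sin θ) (Real.cos θ) σ1 σ2)
      (∫ p, Real.cos θ / (2 * n) * ∑ i, ∑ j, gibbsDeriv β p.1 σ1 (Jmat i j) *
        gibbsDeriv β (Real.sin θ • p.1 + Real.cos θ • p.2) σ2 (Jmat i j) ∂(skPair n)) θ := by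
  have hsc : Real.sin θ ^ 2 + Real.cos θ ^ 2 = 1 := Real.sin_sq_add_cos_sq θ
  have hsnd : MeasurePreserving Prod.snd (skPair n) (skMeasure n) := measurePreserving_snd
  refine (hasDerivAt_coupledWeight_direction β θ σ1 σ2).congr_deriv ?_
  set s := Real.sin θ
  set c := Real.cos θ
  have hback : ∀ F : (Fin n → Fin n → ℝ) → (Fin n → Fin n → ℝ) → (Fin n → Fin n → ℝ) → ℝ,
      ∫ p, F p.1 (s • p.1 + c • p.2) (c • p.1 - s • p.2) ∂(skPair n)
        = ∫ q, F (s • q.1 + c • q.2) q.1 q.2 ∂(skPair n) := by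
    intro F
    rw [← integral_reflPair_skPair hsc fun q => F (s • q.1 + c • q.2) q.1 q.2]
    congr 1
    funext p
    have := congrArg Prod.fst (reflPair_reflPair hsc p)
    change s • (reflPair s c p).1 + c • (reflPair s c p).2 = p.1 at this
    rw [this]
    rfl
  rw [hback fun x y z => gibbs β x σ1 * gibbsDeriv β y σ2 z,
    hback fun x y _ => c / (2 * n) * ∑ i, ∑ j, gibbsDeriv β x σ1 (Jmat i j) *
      gibbsDeriv β y σ2 (Jmat i j)]
  have hI1 : ∀ i j, Integrable (fun q : (Fin n → Fin n → ℝ) × (Fin n → Fin n → ℝ) =>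
      gibbsDeriv β q.1 σ2 (Jmat i j) * (gibbs β (s • q.1 + c • q.2) σ1 * q.2 i j)) (skPair n) := by
    intro i j
    refine Integrable.bdd_mul (c := 2 * |β| * ∑ a, ∑ b, |Jmat i j a b|) (Integrable.bdd_mul (c := 1)
      (hsnd.integrable_comp_of_integrable (integrable_entry_skMeasure i j)) ?_ ?_) ?_ ?_
    · exact (continuous_gibbs_comp β σ1 (by fun_prop)).aestronglyMeasurable
    · exact ae_of_all _ fun q => abs_gibbs_le_one _ _ _
    · exact (continuous_gibbsDeriv_comp β σ2 continuous_fst continuous_const).aestronglyMeasurable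
    · exact ae_of_all _ fun q => abs_gibbsDeriv_le _ _ _ _
  have hI2 : ∀ i j, Integrable (fun q : (Fin n → Fin n → ℝ) × (Fin n → Fin n → ℝ) =>
      gibbsDeriv β q.1 σ2 (Jmat i j) *
        (1 / (2 * n) * (c * gibbsDeriv β (s • q.1 + c • q.2) σ1 (Jmat i j)))) (skPair n) := by
    intro i j
    refine Integrable.bdd_mul (c := 2 * |β| * ∑ a, ∑ b, |Jmat i j a b|) (Integrable.const_mul
      (Integrable.const_mul (Integrable.of_bound ?_ (2 * |β| * ∑ a, ∑ b, |Jmat i j a b|) ?_) _) _)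
      ?_ ?_
    · exact (continuous_gibbsDeriv_comp β σ1 (by fun_prop) continuous_const).aestronglyMeasurable
    · exact ae_of_all _ fun q => abs_gibbsDeriv_le _ _ _ _
    · exact (continuous_gibbsDeriv_comp β σ2 continuous_fst continuous_const).aestronglyMeasurable
    · exact ae_of_all _ fun q => abs_gibbsDeriv_le _ _ _ _
  calc ∫ q, gibbs β (s • q.1 + c • q.2) σ1 * gibbsDeriv β q.1 σ2 q.2 ∂(skPair n)
      = ∫ q, ∑ i, ∑ j, gibbsDeriv β q.1 σ2 (Jmat i j) *
          (gibbs β (s • q.1 + c • q.2) σ1 * q.2 i j) ∂(skPair n) := by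
        congr 1; funext q
        rw [gibbsDeriv_eq_sum_Jmat, Finset.mul_sum]
        refine Finset.sum_congr rfl fun i _ => ?_
        rw [Finset.mul_sum]
        refine Finset.sum_congr rfl fun j _ => ?_
        ring
    _ = ∑ i, ∑ j, ∫ q, gibbsDeriv β q.1 σ2 (Jmat i j) *
          (gibbs β (s • q.1 + c • q.2) σ1 * q.2 i j) ∂(skPair n) := by
        rw [integral_finsetSum _ fun i _ => integrable_finsetSum _ fun j _ => hI1 i j]
        exact Finset.sum_congr rfl fun i _ => integral_finsetSum _ fun j _ => hI1 i j
    _ = ∑ i, ∑ j, ∫ q, gibbsDeriv β q.1 σ2 (Jmat i j) *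
          (1 / (2 * n) * (c * gibbsDeriv β (s • q.1 + c • q.2) σ1 (Jmat i j))) ∂(skPair n) := by
        refine Finset.sum_congr rfl fun i _ => Finset.sum_congr rfl fun j _ => ?_
        have e1 := integral_prod _ (hI1 i j)
        have e2 := integral_prod _ (hI2 i j)
        refine (e1.trans ?_).trans e2.symm
        congr 1; funext y
        simp only
        rw [integral_const_mul, integral_const_mul, (integral_gibbs_mul_entry β s c σ1 y i j).2,
          ← integral_const_mul (1 / (2 * n : ℝ))]
    _ = _ := by
        rw [← Finset.sum_congr rfl fun i _ => integral_finsetSum _ fun j _ => hI2 i j,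
          ← integral_finsetSum _ fun i _ => integrable_finsetSum _ fun j _ => hI2 i j]
        congr 1; funext q
        rw [Finset.mul_sum]
        refine Finset.sum_congr rfl fun i _ => ?_
        rw [Finset.mul_sum]
        refine Finset.sum_congr rfl fun j _ => ?_
        ring

/-- Chebyshev's sum inequality for a probability weight. -/
theorem sum_mul_sum_le_sum_of_monovary {ι : Type*} [Fintype ι] {w e r : ι → ℝ}
    (hw : ∀ x, 0 ≤ w x) (h1 : ∑ x, w x = 1) (her : ∀ x y, 0 ≤ (e x - e y) * (r x - r y)) :
    (∑ x, w x * e x) * (∑ x, w x * r x) ≤ ∑ x, w x * (e x * r x) := by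
  have h : 0 ≤ ∑ x, ∑ y, w x * w y * ((e x - e y) * (r x - r y)) :=
    Finset.sum_nonneg fun x _ => Finset.sum_nonneg fun y _ =>
      mul_nonneg (mul_nonneg (hw x) (hw y)) (her x y)
  have e1 : ∑ x, ∑ y, w x * w y * ((e x - e y) * (r x - r y))
      = (∑ x, w x * (e x * r x)) * (∑ y, w y) + (∑ x, w x) * (∑ y, w y * (e y * r y))
        - (∑ x, w x * e x) * (∑ y, w y * r y) - (∑ x, w x * r x) * (∑ y, w y * e y) := by
    simp only [Finset.sum_mul_sum, ← Finset.sum_add_distrib, ← Finset.sum_sub_distrib]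
    refine Finset.sum_congr rfl fun x _ => Finset.sum_congr rfl fun y _ => ?_
    ring
  rw [e1, h1] at h
  linarith

section Overlap

variable {n : ℕ}

theorem mul_overlap (σ1 σ2 : Fin n → Bool) :
    (n : ℝ) * overlap σ1 σ2 = ∑ i, spin (σ1 i) * spin (σ2 i) := by
  rcases Nat.eq_zero_or_pos n with rfl | hn
  · simp
  · rw [overlap, ← mul_assoc, mul_one_div_cancel (by positivity), one_mul]

theorem abs_overlap_le_one (σ1 σ2 : Fin n → Bool) : |overlap σ1 σ2| ≤ 1 := by
  rw [overlap, abs_mul, abs_of_nonneg (by positivity)]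
  have h : |∑ i, spin (σ1 i) * spin (σ2 i)| ≤ n := by
    refine (Finset.abs_sum_le_sum_abs _ _).trans ?_
    simp [abs_mul, abs_spin]
  calc 1 / (n : ℝ) * |∑ i, spin (σ1 i) * spin (σ2 i)| ≤ 1 / (n : ℝ) * n := by gcongr
    _ ≤ 1 := by rw [one_div]; exact inv_mul_le_one

theorem sum_Ham_Jmat_mul (σ1 σ2 : Fin n → Bool) :
    ∑ i, ∑ j, Ham (Jmat i j) σ1 * Ham (Jmat i j) σ2 = n ^ 2 * overlap σ1 σ2 ^ 2 := by
  rw [← mul_pow, mul_overlap, pow_two, Finset.sum_mul_sum]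
  refine Finset.sum_congr rfl fun i _ => Finset.sum_congr rfl fun j _ => ?_
  rw [Ham_Jmat, Ham_Jmat]
  ring

theorem sum_gibbsDeriv_Jmat_mul (β : ℝ) (X Y : Fin n → Fin n → ℝ) (σ1 σ2 : Fin n → Bool) :
    ∑ i, ∑ j, gibbsDeriv β X σ1 (Jmat i j) * gibbsDeriv β Y σ2 (Jmat i j)
      = β ^ 2 * n ^ 2 * (gibbs β X σ1 * gibbs β Y σ2) *
        (overlap σ1 σ2 ^ 2 - ∑ τ, gibbs β Y τ * overlap σ1 τ ^ 2
          - ∑ τ, gibbs β X τ * overlap τ σ2 ^ 2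
          + ∑ τ, ∑ τ', gibbs β X τ * gibbs β Y τ' * overlap τ τ' ^ 2) := by
  have hswap : ∀ (f g : Fin n → Fin n → ℝ) (c : ℝ),
      ∑ i, ∑ j, c * (f i j * g i j) = c * ∑ i, ∑ j, f i j * g i j := by
    intro f g c
    simp only [Finset.mul_sum]
  have hY : ∀ τ1 : Fin n → Bool, ∑ i, ∑ j, Ham (Jmat i j) τ1 *
      (∑ τ, gibbs β Y τ * Ham (Jmat i j) τ) = n ^ 2 * ∑ τ, gibbs β Y τ * overlap τ1 τ ^ 2 := by
    intro τ1
    simp only [Finset.mul_sum]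
    rw [Finset.sum_congr rfl fun i _ => Finset.sum_comm, Finset.sum_comm]
    refine Finset.sum_congr rfl fun τ _ => ?_
    rw [show (n : ℝ) ^ 2 * (gibbs β Y τ * overlap τ1 τ ^ 2)
      = gibbs β Y τ * (n ^ 2 * overlap τ1 τ ^ 2) by ring, ← sum_Ham_Jmat_mul, ← hswap]
    refine Finset.sum_congr rfl fun i _ => Finset.sum_congr rfl fun j _ => ?_
    ring
  have hX : ∀ h : Fin n → Fin n → ℝ, ∑ i, ∑ j, (∑ τ, gibbs β X τ * Ham (Jmat i j) τ) * h i j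
      = ∑ τ, gibbs β X τ * ∑ i, ∑ j, Ham (Jmat i j) τ * h i j := by
    intro h
    simp only [Finset.sum_mul]
    rw [Finset.sum_congr rfl fun i _ => Finset.sum_comm, Finset.sum_comm]
    refine Finset.sum_congr rfl fun τ _ => ?_
    rw [← hswap]
    refine Finset.sum_congr rfl fun i _ => Finset.sum_congr rfl fun j _ => ?_
    ring
  have hXs := hX fun i j => Ham (Jmat i j) σ2
  have hXY := hX fun i j => ∑ τ, gibbs β Y τ * Ham (Jmat i j) τ
  simp only [hY] at hXY
  simp only [sum_Ham_Jmat_mul] at hXs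
  calc _ = β ^ 2 * (gibbs β X σ1 * gibbs β Y σ2) *
        (∑ i, ∑ j, Ham (Jmat i j) σ1 * Ham (Jmat i j) σ2
        - ∑ i, ∑ j, Ham (Jmat i j) σ1 * (∑ τ, gibbs β Y τ * Ham (Jmat i j) τ)
        - ∑ i, ∑ j, (∑ τ, gibbs β X τ * Ham (Jmat i j) τ) * Ham (Jmat i j) σ2
        + ∑ i, ∑ j, (∑ τ, gibbs β X τ * Ham (Jmat i j) τ) *
            (∑ τ, gibbs β Y τ * Ham (Jmat i j) τ)) := by
        simp only [← Finset.sum_sub_distrib, ← Finset.sum_add_distrib]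
        rw [Finset.mul_sum]
        refine Finset.sum_congr rfl fun i _ => ?_
        rw [Finset.mul_sum]
        refine Finset.sum_congr rfl fun j _ => ?_
        unfold gibbsDeriv
        ring
    _ = _ := by
        rw [hXs, hXY, hY, sum_Ham_Jmat_mul]
        have e1 : ∑ τ, gibbs β X τ * (n ^ 2 * overlap τ σ2 ^ 2)
            = n ^ 2 * ∑ τ, gibbs β X τ * overlap τ σ2 ^ 2 := by
          rw [Finset.mul_sum]
          exact Finset.sum_congr rfl fun τ _ => by ring
        have e2 : ∑ τ, gibbs β X τ * (n ^ 2 * ∑ τ', gibbs β Y τ' * overlap τ τ' ^ 2)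
            = n ^ 2 * ∑ τ, ∑ τ', gibbs β X τ * gibbs β Y τ' * overlap τ τ' ^ 2 := by
          simp only [Finset.mul_sum]
          exact Finset.sum_congr rfl fun τ _ => Finset.sum_congr rfl fun τ' _ => by ring
        rw [e1, e2]
        ring

/-- The integrand of the derivative of the interpolated exponential moment is nonpositive. -/
theorem sum_exp_overlap_interpolation_nonpos (β : ℝ) (X Y : Fin n → Fin n → ℝ) {k c : ℝ}
    (hk : 0 ≤ k) (hc : 0 ≤ c) :
    ∑ σ1, ∑ σ2, (Real.exp (k * overlap σ1 σ2 ^ 2) * (-(β ^ 2 * c * n * overlap σ1 σ2 ^ 2)) *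
        (gibbs β X σ1 * gibbs β Y σ2) + Real.exp (k * overlap σ1 σ2 ^ 2) *
        (c / (2 * n) * ∑ i, ∑ j, gibbsDeriv β X σ1 (Jmat i j) * gibbsDeriv β Y σ2 (Jmat i j)))
      ≤ 0 := by
  set A := ∑ τ, ∑ τ', gibbs β X τ * gibbs β Y τ' * overlap τ τ' ^ 2 with hA
  have hbound : ∀ σ1 σ2 : Fin n → Bool,
      Real.exp (k * overlap σ1 σ2 ^ 2) * (-(β ^ 2 * c * n * overlap σ1 σ2 ^ 2)) *
        (gibbs β X σ1 * gibbs β Y σ2) + Real.exp (k * overlap σ1 σ2 ^ 2) *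
        (c / (2 * n) * ∑ i, ∑ j, gibbsDeriv β X σ1 (Jmat i j) * gibbsDeriv β Y σ2 (Jmat i j))
      ≤ β ^ 2 * c * n / 2 * (A * (gibbs β X σ1 * gibbs β Y σ2 * Real.exp (k * overlap σ1 σ2 ^ 2))
        - gibbs β X σ1 * gibbs β Y σ2 *
          (Real.exp (k * overlap σ1 σ2 ^ 2) * overlap σ1 σ2 ^ 2)) := by
    intro σ1 σ2
    rw [sum_gibbsDeriv_Jmat_mul, ← hA]
    have hn : c / (2 * n) * (β ^ 2 * n ^ 2) = β ^ 2 * c * n / 2 := by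
      rcases Nat.eq_zero_or_pos n with rfl | hn
      · simp
      · field_simp
    have hp : 0 ≤ gibbs β X σ1 * gibbs β Y σ2 :=
      mul_nonneg (gibbs_nonneg _ _ _) (gibbs_nonneg _ _ _)
    have h1 : 0 ≤ ∑ τ, gibbs β Y τ * overlap σ1 τ ^ 2 :=
      Finset.sum_nonneg fun τ _ => mul_nonneg (gibbs_nonneg _ _ _) (sq_nonneg _)
    have h2 : 0 ≤ ∑ τ, gibbs β X τ * overlap τ σ2 ^ 2 :=
      Finset.sum_nonneg fun τ _ => mul_nonneg (gibbs_nonneg _ _ _) (sq_nonneg _)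
    have he := (Real.exp_pos (k * overlap σ1 σ2 ^ 2)).le
    have hb : 0 ≤ β ^ 2 * c * n / 2 := by positivity
    have hpos := mul_nonneg hb (mul_nonneg (mul_nonneg he hp) (add_nonneg h1 h2))
    have h3 : ∀ p x : ℝ, c / (2 * n) * (β ^ 2 * n ^ 2 * p * x) = β ^ 2 * c * n / 2 * (p * x) := by
      intro p x
      rw [← hn]; ring
    rw [h3]
    linarith
  refine (Finset.sum_le_sum fun σ1 _ => Finset.sum_le_sum fun σ2 _ => hbound σ1 σ2).trans ?_
  have hcheb := sum_mul_sum_le_sum_of_monovary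
    (w := fun x : (Fin n → Bool) × (Fin n → Bool) => gibbs β X x.1 * gibbs β Y x.2)
    (e := fun x => Real.exp (k * overlap x.1 x.2 ^ 2)) (r := fun x => overlap x.1 x.2 ^ 2)
    (fun x => mul_nonneg (gibbs_nonneg _ _ _) (gibbs_nonneg _ _ _)) ?_ ?_
  · simp only [Fintype.sum_prod_type] at hcheb
    simp only [← Finset.mul_sum, Finset.sum_sub_distrib]
    refine mul_nonpos_of_nonneg_of_nonpos (by positivity) ?_
    linarith
  · rw [Fintype.sum_prod_type, ← Fintype.sum_mul_sum, sum_gibbs, sum_gibbs, one_mul]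
  · intro x y
    rcases le_total (overlap x.1 x.2 ^ 2) (overlap y.1 y.2 ^ 2) with h | h
    · exact mul_nonneg_of_nonpos_of_nonpos (sub_nonpos.2 (Real.exp_le_exp.2 (by gcongr)))
        (sub_nonpos.2 h)
    · exact mul_nonneg (sub_nonneg.2 (Real.exp_le_exp.2 (by gcongr))) (sub_nonneg.2 h)

/-- The exponential overlap moment along the rotation `θ ↦ (sin θ, cos θ)` of the disorder. -/
noncomputable def expMoment (n : ℕ) (β θ : ℝ) : ℝ :=
  ∑ σ1 : Fin n → Bool, ∑ σ2 : Fin n → Bool,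
    Real.exp ((1 / 2 - β ^ 2 * Real.sin θ) * n * overlap σ1 σ2 ^ 2) *
      coupledWeight β (Real.sin θ) (Real.cos θ) σ1 σ2

theorem integrable_gibbs_mul_gibbs (β s c : ℝ) (σ1 σ2 : Fin n → Bool) :
    Integrable (fun p : (Fin n → Fin n → ℝ) × (Fin n → Fin n → ℝ) =>
      gibbs β p.1 σ1 * gibbs β (s • p.1 + c • p.2) σ2) (skPair n) := by
  refine Integrable.of_bound ((continuous_gibbs_comp β σ1 continuous_fst).mul
    (continuous_gibbs_comp β σ2 (by fun_prop))).aestronglyMeasurable 1 (ae_of_all _ fun p => ?_)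
  rw [norm_mul]
  exact mul_le_one₀ (abs_gibbs_le_one _ _ _) (norm_nonneg _) (abs_gibbs_le_one _ _ _)

theorem integrable_sum_gibbsDeriv_mul (β s c : ℝ) (σ1 σ2 : Fin n → Bool) :
    Integrable (fun p : (Fin n → Fin n → ℝ) × (Fin n → Fin n → ℝ) =>
      ∑ i, ∑ j, gibbsDeriv β p.1 σ1 (Jmat i j) *
        gibbsDeriv β (s • p.1 + c • p.2) σ2 (Jmat i j)) (skPair n) := by
  refine integrable_finsetSum _ fun i _ => integrable_finsetSum _ fun j _ => ?_
  refine Integrable.of_bound ((continuous_gibbsDeriv_comp β σ1 continuous_fst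
    continuous_const).mul (continuous_gibbsDeriv_comp β σ2 (by fun_prop)
    continuous_const)).aestronglyMeasurable
    ((2 * |β| * ∑ a, ∑ b, |Jmat i j a b|) * (2 * |β| * ∑ a, ∑ b, |Jmat i j a b|))
    (ae_of_all _ fun p => ?_)
  rw [norm_mul]
  exact mul_le_mul (abs_gibbsDeriv_le _ _ _ _) (abs_gibbsDeriv_le _ _ _ _) (norm_nonneg _)
    (by positivity)

theorem exists_hasDerivAt_expMoment_nonpos (β θ : ℝ) (hθ : 0 ≤ Real.cos θ)
    (hβ : β ^ 2 * Real.sin θ ≤ 1 / 2) :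
    ∃ V' ≤ 0, HasDerivAt (expMoment n β) V' θ := by
  have hE : ∀ σ1 σ2 : Fin n → Bool, HasDerivAt
      (fun θ => Real.exp ((1 / 2 - β ^ 2 * Real.sin θ) * n * overlap σ1 σ2 ^ 2))
      (Real.exp ((1 / 2 - β ^ 2 * Real.sin θ) * n * overlap σ1 σ2 ^ 2) *
        (-(β ^ 2 * Real.cos θ * n * overlap σ1 σ2 ^ 2))) θ := by
    intro σ1 σ2
    refine (HasDerivAt.congr_deriv (((((Real.hasDerivAt_sin θ).const_mul (β ^ 2)).const_sub
      (1 / 2)).mul_const (n : ℝ)).mul_const (overlap σ1 σ2 ^ 2)) ?_).exp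
    ring
  have hV := HasDerivAt.fun_sum (u := Finset.univ) fun σ1 (_ : σ1 ∈ Finset.univ) =>
    HasDerivAt.fun_sum (u := Finset.univ) fun σ2 (_ : σ2 ∈ Finset.univ) =>
      (hE σ1 σ2).mul (hasDerivAt_coupledWeight (n := n) β θ σ1 σ2)
  refine ⟨_, ?_, hV⟩
  have hint : ∀ σ1 σ2 : Fin n → Bool, Integrable
      (fun p : (Fin n → Fin n → ℝ) × (Fin n → Fin n → ℝ) =>
      Real.exp ((1 / 2 - β ^ 2 * Real.sin θ) * n * overlap σ1 σ2 ^ 2) *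
        (-(β ^ 2 * Real.cos θ * n * overlap σ1 σ2 ^ 2)) *
        (gibbs β p.1 σ1 * gibbs β (Real.sin θ • p.1 + Real.cos θ • p.2) σ2) +
        Real.exp ((1 / 2 - β ^ 2 * Real.sin θ) * n * overlap σ1 σ2 ^ 2) *
        (Real.cos θ / (2 * n) * ∑ i, ∑ j, gibbsDeriv β p.1 σ1 (Jmat i j) *
          gibbsDeriv β (Real.sin θ • p.1 + Real.cos θ • p.2) σ2 (Jmat i j))) (skPair n) :=
    fun σ1 σ2 => ((integrable_gibbs_mul_gibbs β _ _ σ1 σ2).const_mul _).add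
      (((integrable_sum_gibbsDeriv_mul β _ _ σ1 σ2).const_mul _).const_mul _)
  have hnonpos := integral_nonpos (μ := skPair n) fun p =>
    sum_exp_overlap_interpolation_nonpos β p.1 (Real.sin θ • p.1 + Real.cos θ • p.2)
      (k := (1 / 2 - β ^ 2 * Real.sin θ) * n) (c := Real.cos θ)
      (mul_nonneg (by linarith) (Nat.cast_nonneg n)) hθ
  rw [integral_finsetSum _ fun σ1 _ => integrable_finsetSum _ fun σ2 _ => hint σ1 σ2] at hnonpos
  refine le_of_eq_of_le (Finset.sum_congr rfl fun σ1 _ => ?_) hnonpos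
  rw [integral_finsetSum _ fun σ2 _ => hint σ1 σ2]
  refine Finset.sum_congr rfl fun σ2 _ => ?_
  rw [integral_add ((integrable_gibbs_mul_gibbs β _ _ σ1 σ2).const_mul _)
    (((integrable_sum_gibbsDeriv_mul β _ _ σ1 σ2).const_mul _).const_mul _)]
  congr 1 <;> exact (integral_const_mul _ _).symm

theorem expMoment_le_expMoment_zero (β : ℝ) {θ : ℝ} (h0 : 0 ≤ θ) (h1 : θ ≤ Real.pi / 2)
    (hβ : β ^ 2 * Real.sin θ ≤ 1 / 2) : expMoment n β θ ≤ expMoment n β 0 := by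
  have hd : ∀ x ∈ Set.Icc 0 θ, ∃ V' ≤ 0, HasDerivAt (expMoment n β) V' x := by
    intro x hx
    refine exists_hasDerivAt_expMoment_nonpos β x
      (Real.cos_nonneg_of_neg_pi_div_two_le_of_le (by linarith [hx.1, Real.pi_pos])
        (hx.2.trans h1)) (le_trans ?_ hβ)
    gcongr
    exact Real.sin_le_sin_of_le_of_le_pi_div_two (by linarith [hx.1, Real.pi_pos]) h1 hx.2
  have hanti : AntitoneOn (expMoment n β) (Set.Icc 0 θ) := by
    refine antitoneOn_of_deriv_nonpos (convex_Icc 0 θ) ?_ ?_ ?_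
    · intro x hx
      obtain ⟨_, _, h⟩ := hd x hx
      exact h.continuousAt.continuousWithinAt
    · intro x hx
      obtain ⟨_, _, h⟩ := hd x (interior_subset hx)
      exact h.differentiableAt.differentiableWithinAt
    · intro x hx
      obtain ⟨_, h', h⟩ := hd x (interior_subset hx)
      rwa [h.deriv]
  exact hanti (Set.left_mem_Icc.2 h0) (Set.right_mem_Icc.2 h0) h0

end Overlap

section Gauge

variable {n : ℕ}

theorem spin_beq (a b : Bool) : spin (a == b) = spin a * spin b := by
  cases a <;> cases b <;> simp [spin]

/-- The gauge transformation of the disorder by the spin configuration `ε`. -/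
noncomputable def gaugeFlip (ε : Fin n → Bool) (X : Fin n → Fin n → ℝ) : Fin n → Fin n → ℝ :=
  fun i j => spin (ε i) * spin (ε j) * X i j

theorem measurePreserving_gaugeFlip (ε : Fin n → Bool) :
    MeasurePreserving (gaugeFlip ε) (skMeasure n) (skMeasure n) := by
  refine measurePreserving_pi _ _ fun i => measurePreserving_pi _ _ fun j => ?_
  refine ⟨by fun_prop, ?_⟩
  have h : (spin (ε i) * spin (ε j)) ^ 2 = 1 := by
    rw [mul_pow, pow_two, pow_two, spin_mul_self, spin_mul_self, one_mul]
  rw [gaussianReal_map_const_mul, mul_zero]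
  congr 1
  rw [show (NNReal.mk ((spin (ε i) * spin (ε j)) ^ 2) (sq_nonneg _)) = 1 from NNReal.eq h, one_mul]

theorem Ham_gaugeFlip (ε : Fin n → Bool) (X : Fin n → Fin n → ℝ) (σ : Fin n → Bool) :
    Ham (gaugeFlip ε X) σ = Ham X fun i => σ i == ε i := by
  refine Finset.sum_congr rfl fun i _ => Finset.sum_congr rfl fun j _ => ?_
  rw [spin_beq, spin_beq, gaugeFlip]
  ring

theorem beq_beq_cancel (ε σ : Fin n → Bool) : (fun i => (σ i == ε i) == ε i) = σ := by
  funext i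
  cases σ i <;> cases ε i <;> rfl

theorem gibbs_gaugeFlip (β : ℝ) (ε : Fin n → Bool) (X : Fin n → Fin n → ℝ) (σ : Fin n → Bool) :
    gibbs β (gaugeFlip ε X) σ = gibbs β X fun i => σ i == ε i := by
  have hZ : Zpart β (gaugeFlip ε X) = Zpart β X := by
    unfold Zpart
    simp only [Ham_gaugeFlip]
    exact Equiv.sum_comp (Equiv.mk (fun (σ : Fin n → Bool) i => σ i == ε i)
      (fun (σ : Fin n → Bool) i => σ i == ε i) (beq_beq_cancel ε) (beq_beq_cancel ε))
      fun σ => Real.exp (-β * Ham X σ)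
  rw [gibbs, gibbs, hZ, Ham_gaugeFlip]

theorem integrable_gibbs (β : ℝ) (σ : Fin n → Bool) :
    Integrable (fun X => gibbs β X σ) (skMeasure n) :=
  Integrable.of_bound (continuous_gibbs β σ).aestronglyMeasurable 1
    (ae_of_all _ fun X => abs_gibbs_le_one β X σ)

/-- By gauge symmetry the expected Gibbs weights are uniform. -/
theorem integral_gibbs (β : ℝ) (σ : Fin n → Bool) :
    ∫ X, gibbs β X σ ∂(skMeasure n) = 1 / 2 ^ n := by
  have heq : ∀ τ : Fin n → Bool,
      ∫ X, gibbs β X τ ∂(skMeasure n) = ∫ X, gibbs β X σ ∂(skMeasure n) := by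
    intro τ
    have hg := measurePreserving_gaugeFlip fun i => τ i == σ i
    have h := integral_map (μ := skMeasure n) (f := fun X => gibbs β X σ) hg.measurable.aemeasurable
      (continuous_gibbs β σ).aestronglyMeasurable
    rw [hg.map_eq] at h
    rw [h]
    simp only [gibbs_gaugeFlip]
    congr 1; funext X
    congr 1; funext i
    cases τ i <;> cases σ i <;> rfl
  have hsum : ∑ τ : Fin n → Bool, ∫ X, gibbs β X τ ∂(skMeasure n) = 1 := by
    rw [← integral_finsetSum _ fun τ _ => integrable_gibbs β τ]
    simp [sum_gibbs]
  simp only [heq, Finset.sum_const, Finset.card_univ, Fintype.card_fun, Fintype.card_bool,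
    Fintype.card_fin, nsmul_eq_mul, Nat.cast_pow, Nat.cast_ofNat] at hsum
  rw [eq_div_iff (by positivity), mul_comm]
  exact hsum

theorem coupledWeight_zero_one (β : ℝ) (σ1 σ2 : Fin n → Bool) :
    coupledWeight β 0 1 σ1 σ2 = 1 / 2 ^ n * (1 / 2 ^ n) := by
  have h := integral_prod_mul (μ := skMeasure n) (ν := skMeasure n)
    (fun X => gibbs β X σ1) (fun X => gibbs β X σ2)
  simp only [integral_gibbs] at h
  rw [← h]
  simp [coupledWeight, skPair]

theorem coupledWeight_nonneg (β s c : ℝ) (σ1 σ2 : Fin n → Bool) :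
    0 ≤ coupledWeight β s c σ1 σ2 :=
  integral_nonneg fun _ => mul_nonneg (gibbs_nonneg _ _ _) (gibbs_nonneg _ _ _)

theorem sum_coupledWeight (β s c : ℝ) :
    ∑ σ1 : Fin n → Bool, ∑ σ2 : Fin n → Bool, coupledWeight β s c σ1 σ2 = 1 := by
  unfold coupledWeight
  rw [← Finset.sum_congr rfl fun σ1 _ => integral_finsetSum _ fun σ2 _ =>
    integrable_gibbs_mul_gibbs β s c σ1 σ2, ← integral_finsetSum _ fun σ1 _ =>
    integrable_finsetSum _ fun σ2 _ => integrable_gibbs_mul_gibbs β s c σ1 σ2]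
  simp [← Fintype.sum_mul_sum, sum_gibbs]

end Gauge

section SmallCorrelation

variable {n : ℕ}

theorem sum_exp_mul_overlap_le (a : ℝ) (σ1 : Fin n → Bool) :
    ∑ σ2 : Fin n → Bool, Real.exp (a * (n * overlap σ1 σ2)) ≤ 2 ^ n * Real.exp (n * (a ^ 2 / 2)) := by
  have h := Finset.prod_univ_sum (fun _ : Fin n => (Finset.univ : Finset Bool))
    fun i b => Real.exp (a * (spin (σ1 i) * spin b))
  rw [Fintype.piFinset_univ] at h
  have e : ∀ σ2 : Fin n → Bool, Real.exp (a * (n * overlap σ1 σ2))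
      = ∏ i, Real.exp (a * (spin (σ1 i) * spin (σ2 i))) := by
    intro σ2
    rw [mul_overlap, Finset.mul_sum, Real.exp_sum]
  simp only [e]
  rw [← h, Real.exp_nat_mul, ← mul_pow]
  have hb : ∀ i : Fin n, ∑ b, Real.exp (a * (spin (σ1 i) * spin b)) = 2 * Real.cosh a := by
    intro i
    rw [Real.cosh_eq]
    cases σ1 i <;> simp [spin] <;> ring
  simp only [hb, Finset.prod_const, Finset.card_univ, Fintype.card_fin]
  have := Real.cosh_le_exp_half_sq a
  have := (Real.cosh_pos a).le
  gcongr

theorem exists_int_eq_mul_overlap (σ1 σ2 : Fin n → Bool) :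
    ∃ k ∈ Finset.Icc (-n : ℤ) n, (n : ℝ) * overlap σ1 σ2 = k := by
  have hs : ∀ b, ∃ k : ℤ, spin b = k := by
    intro b
    cases b
    · exact ⟨-1, by simp [spin]⟩
    · exact ⟨1, by simp [spin]⟩
  choose f hf using hs
  have e : (n : ℝ) * overlap σ1 σ2 = ((∑ i, f (σ1 i) * f (σ2 i) : ℤ) : ℝ) := by
    rw [mul_overlap]
    push_cast
    simp only [hf]
  refine ⟨_, ?_, e⟩
  have h : |(n : ℝ) * overlap σ1 σ2| ≤ n := by
    rw [abs_mul, Nat.abs_cast]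
    exact mul_le_of_le_one_right (Nat.cast_nonneg n) (abs_overlap_le_one σ1 σ2)
  rw [e] at h
  rw [Finset.mem_Icc, ← abs_le]
  exact_mod_cast h

theorem sum_exp_half_overlap_sq_le (hn : 0 < n) (σ1 : Fin n → Bool) :
    ∑ σ2 : Fin n → Bool, Real.exp (1 / 2 * n * overlap σ1 σ2 ^ 2) ≤ (2 * n + 1) * 2 ^ n := by
  have hn' : (n : ℝ) ≠ 0 := by positivity
  calc ∑ σ2 : Fin n → Bool, Real.exp (1 / 2 * n * overlap σ1 σ2 ^ 2)
      ≤ ∑ σ2 : Fin n → Bool, ∑ k ∈ Finset.Icc (-n : ℤ) n,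
          Real.exp (-(n * ((k / n : ℝ) ^ 2 / 2))) * Real.exp ((k / n : ℝ) * (n * overlap σ1 σ2)) := by
        refine Finset.sum_le_sum fun σ2 _ => ?_
        obtain ⟨k, hk, e⟩ := exists_int_eq_mul_overlap σ1 σ2
        have e' : overlap σ1 σ2 = k / n := by rw [← e]; field_simp
        refine le_of_eq_of_le ?_ (Finset.single_le_sum (f := fun k : ℤ =>
          Real.exp (-(n * ((k / n : ℝ) ^ 2 / 2))) * Real.exp ((k / n : ℝ) * (n * overlap σ1 σ2)))
          (fun k _ => by positivity) hk)
        rw [← Real.exp_add, e']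
        congr 1
        field_simp
        ring
    _ = ∑ k ∈ Finset.Icc (-n : ℤ) n, Real.exp (-(n * ((k / n : ℝ) ^ 2 / 2))) *
          ∑ σ2 : Fin n → Bool, Real.exp ((k / n : ℝ) * (n * overlap σ1 σ2)) := by
        rw [Finset.sum_comm]
        simp only [Finset.mul_sum]
    _ ≤ ∑ k ∈ Finset.Icc (-n : ℤ) n, (2 : ℝ) ^ n := by
        refine Finset.sum_le_sum fun k _ => ?_
        refine (mul_le_mul_of_nonneg_left (sum_exp_mul_overlap_le (k / n) σ1)
          (Real.exp_pos _).le).trans_eq ?_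
        rw [mul_left_comm, ← Real.exp_add, neg_add_cancel, Real.exp_zero, mul_one]
    _ = (2 * n + 1) * 2 ^ n := by
        rw [Finset.sum_const, Int.card_Icc, nsmul_eq_mul,
          show ((n : ℤ) + 1 - -n).toNat = 2 * n + 1 by omega]
        push_cast
        ring

theorem expMoment_zero_le (hn : 0 < n) (β : ℝ) : expMoment n β 0 ≤ 2 * n + 1 := by
  unfold expMoment
  simp only [Real.sin_zero, Real.cos_zero, coupledWeight_zero_one, mul_zero, sub_zero,
    ← Finset.sum_mul]
  calc (∑ σ1 : Fin n → Bool, ∑ σ2 : Fin n → Bool, Real.exp (1 / 2 * n * overlap σ1 σ2 ^ 2)) *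
        (1 / 2 ^ n * (1 / 2 ^ n))
      ≤ (∑ σ1 : Fin n → Bool, (2 * n + 1) * (2 : ℝ) ^ n) * (1 / 2 ^ n * (1 / 2 ^ n)) := by
        gcongr with σ1
        exact sum_exp_half_overlap_sq_le hn σ1
    _ = 2 * n + 1 := by
        simp only [Finset.sum_const, Finset.card_univ, Fintype.card_fun, Fintype.card_bool,
          Fintype.card_fin, nsmul_eq_mul, Nat.cast_pow, Nat.cast_ofNat]
        field_simp

/-- The expected squared overlap between replicas whose disorders have correlation `ρ`. -/
noncomputable def overlapMoment (n : ℕ) (β ρ : ℝ) : ℝ :=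
  ∑ σ1 : Fin n → Bool, ∑ σ2 : Fin n → Bool,
    overlap σ1 σ2 ^ 2 * coupledWeight β ρ √(1 - ρ ^ 2) σ1 σ2

theorem overlapMoment_le_of_small (hn : 0 < n) {β ρ : ℝ} (h0 : 0 ≤ ρ) (h1 : ρ ≤ 1)
    (hβ : β ^ 2 * ρ ≤ 1 / 4) : overlapMoment n β ρ ≤ 49 / √n := by
  have hsin : Real.sin (Real.arcsin ρ) = ρ := Real.sin_arcsin (by linarith) h1
  have hV : expMoment n β (Real.arcsin ρ) ≤ 2 * n + 1 :=
    (expMoment_le_expMoment_zero β (Real.arcsin_nonneg.2 h0) (Real.arcsin_le_pi_div_two ρ)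
      (by rw [hsin]; linarith)).trans (expMoment_zero_le hn β)
  unfold expMoment at hV
  rw [hsin, Real.cos_arcsin] at hV
  have hr : 0 < √(n : ℝ) := Real.sqrt_pos.2 (by positivity)
  have hrr : √(n : ℝ) ^ 2 = n := Real.sq_sqrt (Nat.cast_nonneg n)
  have hn1 : (1 : ℝ) ≤ n := by exact_mod_cast hn
  have hpt : ∀ x : ℝ, 0 ≤ x →
      x ≤ 1 / √n + 16 / √n ^ 3 * Real.exp ((1 / 2 - β ^ 2 * ρ) * n * x) := by
    intro x hx
    have hy : 0 ≤ n * x / 4 := by positivity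
    have hq := Real.quadratic_le_exp_of_nonneg hy
    have he : Real.exp (n * x / 4) ≤ Real.exp ((1 / 2 - β ^ 2 * ρ) * n * x) := by
      refine Real.exp_le_exp.2 ?_
      have : 0 ≤ (1 / 4 - β ^ 2 * ρ) * (n * x) := mul_nonneg (by linarith) (by positivity)
      linarith
    have hq' : (n * x) ^ 2 / 32 ≤ Real.exp ((1 / 2 - β ^ 2 * ρ) * n * x) := by
      refine le_trans ?_ (hq.trans he)
      nlinarith
    calc x ≤ 1 / √n + √n * x ^ 2 / 2 := by
          have hs : √n * x ≤ 1 + n * x ^ 2 / 2 := by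
            nlinarith [sq_nonneg (√(n : ℝ) * x - 1)]
          have : x * √n ≤ (1 / √n + √n * x ^ 2 / 2) * √n := by
            have e : (1 / √n + √n * x ^ 2 / 2) * √n = 1 + √n ^ 2 * x ^ 2 / 2 := by field_simp
            rw [e, hrr]
            linarith
          exact le_of_mul_le_mul_right this hr
      _ = 1 / √n + 16 / √n ^ 3 * ((n * x) ^ 2 / 32) := by
          have h : ∀ r : ℝ, 0 < r → 1 / r + r * x ^ 2 / 2
              = 1 / r + 16 / r ^ 3 * ((r ^ 2 * x) ^ 2 / 32) := by
            intro r hr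
            field_simp
            ring
          have h' := h _ hr
          rwa [hrr] at h'
      _ ≤ _ := by gcongr
  calc overlapMoment n β ρ
      ≤ ∑ σ1 : Fin n → Bool, ∑ σ2 : Fin n → Bool,
        (1 / √n * coupledWeight β ρ √(1 - ρ ^ 2) σ1 σ2 + 16 / √n ^ 3 *
          (Real.exp ((1 / 2 - β ^ 2 * ρ) * n * overlap σ1 σ2 ^ 2) *
            coupledWeight β ρ √(1 - ρ ^ 2) σ1 σ2)) := by
        refine Finset.sum_le_sum fun σ1 _ => Finset.sum_le_sum fun σ2 _ => ?_
        refine (mul_le_mul_of_nonneg_right (hpt _ (sq_nonneg (overlap σ1 σ2)))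
          (coupledWeight_nonneg β ρ _ σ1 σ2)).trans_eq ?_
        ring
    _ ≤ 1 / √n * 1 + 16 / √n ^ 3 * (2 * n + 1) := by
        simp only [Finset.sum_add_distrib, ← Finset.mul_sum]
        rw [sum_coupledWeight]
        gcongr
    _ ≤ 1 / √n * 1 + 16 / √n ^ 3 * (3 * √n ^ 2) := by
        gcongr
        rw [hrr]
        linarith
    _ = 49 / √n := by
        field_simp
        norm_num

end SmallCorrelation

section Semigroup

variable {n : ℕ}

/-- A linear combination of two independent SK disorders is a rescaled SK disorder. -/
theorem integral_comp_add_skPair {a b r : ℝ} (h : a ^ 2 + b ^ 2 = r ^ 2)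
    (F : (Fin n → Fin n → ℝ) → ℝ) :
    ∫ p, F (a • p.1 + b • p.2) ∂(skPair n) = ∫ u, F (r • u) ∂(skMeasure n) := by
  have hfst : ∫ p, F (r • p.1) ∂(skPair n) = ∫ u, F (r • u) ∂(skMeasure n) := by
    rw [skPair, integral_fun_fst (μ := skMeasure n) (ν := skMeasure n) fun u => F (r • u)]
    simp
  rw [← hfst]
  rcases eq_or_ne r 0 with rfl | hr
  · have ha : a = 0 := by nlinarith [sq_nonneg a, sq_nonneg b]
    have hb : b = 0 := by nlinarith [sq_nonneg a, sq_nonneg b]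
    simp [ha, hb]
  · have h' : (a / r) ^ 2 + (b / r) ^ 2 = 1 := by
      rw [div_pow, div_pow, ← add_div, h, div_self (pow_ne_zero 2 hr)]
    rw [← integral_reflPair_skPair h' fun p => F (r • p.1)]
    congr 1; funext p
    congr 1
    simp only [reflPair, smul_add, smul_smul, mul_div_cancel₀ _ hr]

/-- The correlation of `f` under two SK disorders with correlation `ρ`. -/
noncomputable def correlation (f : (Fin n → Fin n → ℝ) → ℝ) (ρ : ℝ) : ℝ :=
  ∫ p, f p.1 * f (ρ • p.1 + √(1 - ρ ^ 2) • p.2) ∂(skPair n)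

/-- The Cauchy-Schwarz inequality for the Ornstein-Uhlenbeck semigroup. -/
theorem correlation_le_correlation_sq {f : (Fin n → Fin n → ℝ) → ℝ} (hf : Continuous f)
    (hf1 : ∀ x, |f x| ≤ 1) {ρ a : ℝ} (h0 : 0 ≤ ρ) (h1 : ρ ≤ 1) (ha : 0 < a) :
    correlation f ρ ≤ a / 2 + correlation f (ρ ^ 2) / (2 * a) := by
  have hρ : ρ ^ 2 ≤ 1 := pow_le_one₀ h0 h1
  have hρ' : (ρ ^ 2) ^ 2 ≤ 1 := pow_le_one₀ (sq_nonneg ρ) hρ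
  set c := √(1 - ρ ^ 2)
  have hcc : c ^ 2 = 1 - ρ ^ 2 := Real.sq_sqrt (by linarith)
  have hsc : ρ ^ 2 + c ^ 2 = 1 := by linarith
  let T : (Fin n → Fin n → ℝ) → ℝ := fun x => ∫ z, f (ρ • x + c • z) ∂(skMeasure n)
  have hTm : StronglyMeasurable T := by
    have h : StronglyMeasurable fun p : (Fin n → Fin n → ℝ) × (Fin n → Fin n → ℝ) =>
        f (ρ • p.1 + c • p.2) :=
      (hf.comp (by fun_prop : Continuous fun p : (Fin n → Fin n → ℝ) × (Fin n → Fin n → ℝ) =>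
        ρ • p.1 + c • p.2)).stronglyMeasurable
    exact h.integral_prod_right'
  have hT1 : ∀ x, |T x| ≤ 1 := by
    intro x
    have h := norm_integral_le_of_norm_le_const (μ := skMeasure n)
      (f := fun z => f (ρ • x + c • z)) (ae_of_all _ fun z => hf1 (ρ • x + c • z))
    simpa using h
  have hmul : ∀ {x y : ℝ}, |x| ≤ 1 → |y| ≤ 1 → ‖x * y‖ ≤ 1 := by
    intro x y hx hy
    rw [norm_mul]
    exact mul_le_one₀ hx (norm_nonneg _) hy
  have hfm := hf.stronglyMeasurable
  have hI : ∀ {g k : (Fin n → Fin n → ℝ) → ℝ} (s r : ℝ), StronglyMeasurable g →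
      StronglyMeasurable k → (∀ x, |g x| ≤ 1) → (∀ x, |k x| ≤ 1) →
      ∫ p, g p.1 * k (s • p.1 + r • p.2) ∂(skPair n)
        = ∫ x, g x * ∫ z, k (s • x + r • z) ∂(skMeasure n) ∂(skMeasure n) := by
    intro g k s r hg hk hg1 hk1
    have hint : Integrable (fun p : (Fin n → Fin n → ℝ) × (Fin n → Fin n → ℝ) =>
        g p.1 * k (s • p.1 + r • p.2)) (skPair n) :=
      Integrable.of_bound ((hg.comp_measurable measurable_fst).mul
        (hk.comp_measurable (by fun_prop))).aestronglyMeasurable 1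
        (ae_of_all _ fun p => hmul (hg1 _) (hk1 _))
    refine (integral_prod _ hint).trans ?_
    simp only [integral_const_mul]
  have hT2 : ∫ x, T x * T x ∂(skMeasure n) = correlation f (ρ ^ 2) := by
    have hback : ∫ p, T p.1 * f (ρ • p.1 + c • p.2) ∂(skPair n)
        = ∫ p, f p.1 * T (ρ • p.1 + c • p.2) ∂(skPair n) := by
      rw [← integral_reflPair_skPair hsc fun p => f p.1 * T (ρ • p.1 + c • p.2)]
      congr 1; funext p
      have := congrArg Prod.fst (reflPair_reflPair hsc p)
      change ρ • (reflPair ρ c p).1 + c • (reflPair ρ c p).2 = p.1 at this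
      rw [this, mul_comm]
      rfl
    have hinner : ∀ y, ∫ w, T (ρ • y + c • w) ∂(skMeasure n)
        = ∫ u, f (ρ ^ 2 • y + √(1 - (ρ ^ 2) ^ 2) • u) ∂(skMeasure n) := by
      intro y
      have hr : (ρ * c) ^ 2 + c ^ 2 = √(1 - (ρ ^ 2) ^ 2) ^ 2 := by
        rw [Real.sq_sqrt (show 0 ≤ 1 - (ρ ^ 2) ^ 2 by linarith), mul_pow, hcc]
        ring
      rw [← integral_comp_add_skPair hr fun v => f (ρ ^ 2 • y + v)]
      have hcont : Continuous fun p : (Fin n → Fin n → ℝ) × (Fin n → Fin n → ℝ) =>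
          f (ρ ^ 2 • y + ((ρ * c) • p.1 + c • p.2)) := hf.comp (by fun_prop)
      have hint : Integrable (fun p : (Fin n → Fin n → ℝ) × (Fin n → Fin n → ℝ) =>
          f (ρ ^ 2 • y + ((ρ * c) • p.1 + c • p.2))) (skPair n) :=
        Integrable.of_bound hcont.aestronglyMeasurable 1 (ae_of_all _ fun p => hf1 _)
      refine Eq.trans ?_ (integral_prod _ hint).symm
      congr 1; funext w
      refine integral_congr_ae (ae_of_all _ fun z => congrArg f ?_)
      simp only
      module
    rw [← hI ρ c hTm hfm hT1 hf1, hback, hI ρ c hfm hTm hf1 hT1, correlation,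
      hI (ρ ^ 2) _ hfm hfm hf1 hf1]
    simp only [hinner]
  have hfT : correlation f ρ = ∫ x, f x * T x ∂(skMeasure n) := hI ρ c hfm hfm hf1 hf1
  have hTT : Integrable (fun x => T x * T x) (skMeasure n) :=
    Integrable.of_bound (hTm.mul hTm).aestronglyMeasurable 1
      (ae_of_all _ fun x => hmul (hT1 x) (hT1 x))
  calc correlation f ρ ≤ ∫ x, (a / 2 + 1 / (2 * a) * (T x * T x)) ∂(skMeasure n) := by
        rw [hfT]
        refine integral_mono (Integrable.of_bound (hfm.mul hTm).aestronglyMeasurable 1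
          (ae_of_all _ fun x => hmul (hf1 x) (hT1 x)))
          ((integrable_const _).add (hTT.const_mul _)) fun x => ?_
        have hfx : f x ^ 2 ≤ 1 := (sq_le_one_iff_abs_le_one _).2 (hf1 x)
        have h2 : f x * T x * (2 * a) ≤ (a / 2 + 1 / (2 * a) * (T x * T x)) * (2 * a) := by
          have e : (a / 2 + 1 / (2 * a) * (T x * T x)) * (2 * a) = a ^ 2 + T x ^ 2 := by
            field_simp
          rw [e]
          nlinarith [sq_nonneg (a * f x - T x), mul_le_mul_of_nonneg_left hfx (sq_nonneg a)]
        exact le_of_mul_le_mul_right h2 (by positivity)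
    _ = a / 2 + correlation f (ρ ^ 2) / (2 * a) := by
        rw [integral_add (integrable_const _) (hTT.const_mul _), integral_const_mul, hT2]
        simp [div_eq_inv_mul]

/-- The Gibbs average of the pair interaction `σ(i) σ(j)`. -/
noncomputable def pairMean (β : ℝ) (i j : Fin n) (X : Fin n → Fin n → ℝ) : ℝ :=
  ∑ σ, gibbs β X σ * Ham (Jmat i j) σ

theorem continuous_pairMean (β : ℝ) (i j : Fin n) : Continuous (pairMean β i j) :=
  continuous_finsetSum _ fun σ _ => (continuous_gibbs β σ).mul continuous_const

theorem abs_pairMean_le_one (β : ℝ) (i j : Fin n) (X : Fin n → Fin n → ℝ) :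
    |pairMean β i j X| ≤ 1 := by
  rw [← sum_gibbs β X]
  refine (Finset.abs_sum_le_sum_abs _ _).trans_eq (Finset.sum_congr rfl fun σ _ => ?_)
  rw [Ham_Jmat, abs_mul, abs_mul, abs_spin, abs_spin, abs_of_nonneg (gibbs_nonneg β X σ)]
  ring

theorem sq_mul_overlapMoment (β ρ : ℝ) :
    (n : ℝ) ^ 2 * overlapMoment n β ρ = ∑ i : Fin n, ∑ j : Fin n, correlation (pairMean β i j) ρ := by
  have hint := fun σ1 σ2 : Fin n → Bool => integrable_gibbs_mul_gibbs β ρ (√(1 - ρ ^ 2)) σ1 σ2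
  have hc : ∀ i j : Fin n, correlation (pairMean β i j) ρ = ∑ σ1, ∑ σ2,
      Ham (Jmat i j) σ1 * Ham (Jmat i j) σ2 * coupledWeight β ρ √(1 - ρ ^ 2) σ1 σ2 := by
    intro i j
    unfold coupledWeight
    simp only [← integral_const_mul]
    rw [← Finset.sum_congr rfl fun σ1 _ => integral_finsetSum _ fun σ2 _ =>
      (hint σ1 σ2).const_mul _, ← integral_finsetSum _ fun σ1 _ =>
      integrable_finsetSum _ fun σ2 _ => (hint σ1 σ2).const_mul _]
    unfold correlation pairMean
    congr 1; funext p
    rw [Fintype.sum_mul_sum]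
    exact Finset.sum_congr rfl fun σ1 _ => Finset.sum_congr rfl fun σ2 _ => by ring
  simp only [hc]
  rw [overlapMoment, Finset.mul_sum]
  rw [Finset.sum_congr rfl fun i _ => Finset.sum_comm, Finset.sum_comm]
  refine Finset.sum_congr rfl fun σ1 _ => ?_
  rw [Finset.sum_congr rfl fun i _ => Finset.sum_comm, Finset.sum_comm, Finset.mul_sum]
  refine Finset.sum_congr rfl fun σ2 _ => ?_
  simp only [← Finset.sum_mul]
  rw [sum_Ham_Jmat_mul, mul_assoc]

theorem overlapMoment_le_overlapMoment_sq (hn : 0 < n) (β : ℝ) {ρ a : ℝ} (h0 : 0 ≤ ρ)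
    (h1 : ρ ≤ 1) (ha : 0 < a) :
    overlapMoment n β ρ ≤ a / 2 + overlapMoment n β (ρ ^ 2) / (2 * a) := by
  have h : (n : ℝ) ^ 2 * overlapMoment n β ρ
      ≤ n ^ 2 * (a / 2 + overlapMoment n β (ρ ^ 2) / (2 * a)) := by
    rw [sq_mul_overlapMoment, mul_add, ← mul_div_assoc _ _ (2 * a), sq_mul_overlapMoment]
    refine (Finset.sum_le_sum fun i _ => Finset.sum_le_sum fun j _ =>
      correlation_le_correlation_sq (continuous_pairMean β i j) (abs_pairMean_le_one β i j)
        h0 h1 ha).trans_eq ?_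
    simp only [Finset.sum_add_distrib, Finset.sum_div, Finset.sum_const, Finset.card_univ,
      Fintype.card_fin, nsmul_eq_mul]
    ring
  exact le_of_mul_le_mul_left h (by positivity)

theorem overlapMoment_nonneg (β ρ : ℝ) : 0 ≤ overlapMoment n β ρ :=
  Finset.sum_nonneg fun σ1 _ => Finset.sum_nonneg fun σ2 _ =>
    mul_nonneg (sq_nonneg _) (coupledWeight_nonneg β ρ _ σ1 σ2)

end Semigroup

theorem tendsto_overlapMoment_of_small {β ρ : ℝ} (h0 : 0 ≤ ρ) (h1 : ρ ≤ 1)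
    (hβ : β ^ 2 * ρ ≤ 1 / 4) : Tendsto (fun n => overlapMoment n β ρ) atTop (nhds 0) := by
  have hlim : Tendsto (fun n : ℕ => 49 / √(n : ℝ)) atTop (nhds 0) :=
    (Real.tendsto_sqrt_atTop.comp tendsto_natCast_atTop_atTop).const_div_atTop 49
  refine tendsto_of_tendsto_of_tendsto_of_le_of_le' tendsto_const_nhds hlim
    (Eventually.of_forall fun n => overlapMoment_nonneg β ρ) ?_
  filter_upwards [eventually_gt_atTop 0] with n hn
  exact overlapMoment_le_of_small hn h0 h1 hβ

theorem tendsto_overlapMoment_of_sq {β ρ : ℝ} (h0 : 0 ≤ ρ) (h1 : ρ ≤ 1)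
    (h : Tendsto (fun n => overlapMoment n β (ρ ^ 2)) atTop (nhds 0)) :
    Tendsto (fun n => overlapMoment n β ρ) atTop (nhds 0) := by
  rw [Metric.tendsto_atTop'] at *
  intro ε hε
  obtain ⟨N, hN⟩ := h (ε ^ 2) (by positivity)
  refine ⟨N, fun n hn => ?_⟩
  have hb := hN n hn
  rw [Real.dist_eq, sub_zero, abs_of_nonneg (overlapMoment_nonneg _ _)] at hb ⊢
  refine (overlapMoment_le_overlapMoment_sq (by omega) β h0 h1 hε).trans_lt ?_
  have : overlapMoment n β (ρ ^ 2) / (2 * ε) < ε / 2 := by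
    rw [div_lt_iff₀ (by positivity)]
    linarith
  linarith

theorem tendsto_overlapMoment {β ρ : ℝ} (h0 : 0 ≤ ρ) (h1 : ρ < 1) :
    Tendsto (fun n => overlapMoment n β ρ) atTop (nhds 0) := by
  have hiter : ∀ (m : ℕ) (ρ : ℝ), 0 ≤ ρ → ρ ≤ 1 → β ^ 2 * ρ ^ 2 ^ m ≤ 1 / 4 →
      Tendsto (fun n => overlapMoment n β ρ) atTop (nhds 0) := by
    intro m
    induction m with
    | zero =>
      intro ρ h0 h1 h
      exact tendsto_overlapMoment_of_small h0 h1 (by simpa using h)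
    | succ m ih =>
      intro ρ h0 h1 h
      refine tendsto_overlapMoment_of_sq h0 h1 (ih (ρ ^ 2) (sq_nonneg ρ) (pow_le_one₀ h0 h1) ?_)
      rwa [← pow_mul, ← pow_succ']
  obtain ⟨k, hk⟩ := exists_pow_lt_of_lt_one (show 0 < 1 / (4 * (β ^ 2 + 1)) by positivity) h1
  refine hiter k ρ h0 h1.le ?_
  have hle : ρ ^ 2 ^ k ≤ 1 / (4 * (β ^ 2 + 1)) :=
    (pow_le_pow_of_le_one h0 h1.le Nat.lt_two_pow_self.le).trans hk.le
  calc β ^ 2 * ρ ^ 2 ^ k ≤ (β ^ 2 + 1) * (1 / (4 * (β ^ 2 + 1))) := by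
        gcongr
        linarith
    _ = 1 / 4 := by field_simp

theorem integral_avg2c_skPerturb (n : ℕ) (β : ℝ) {t : ℝ} (ht1 : t ≤ 1) :
    ∫ p, avg2c β p.1 (skPerturb t p.1 p.2) (fun σ1 σ2 => (overlap σ1 σ2) ^ 2) ∂(skPair n)
      = overlapMoment n β √(1 - t) := by
  have ht : 1 - √(1 - t) ^ 2 = t := by rw [Real.sq_sqrt (by linarith)]; ring
  rw [overlapMoment, ht]
  have hint := fun σ1 σ2 : Fin n → Bool => integrable_gibbs_mul_gibbs β √(1 - t) √t σ1 σ2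
  unfold coupledWeight
  simp only [← integral_const_mul]
  rw [← Finset.sum_congr rfl fun σ1 _ => integral_finsetSum _ fun σ2 _ =>
    (hint σ1 σ2).const_mul _, ← integral_finsetSum _ fun σ1 _ =>
    integrable_finsetSum _ fun σ2 _ => (hint σ1 σ2).const_mul _]
  congr 1; funext p
  exact Finset.sum_congr rfl fun σ1 _ => Finset.sum_congr rfl fun σ2 _ => mul_assoc _ _ _

/-- disorder chaos for the SK model: the coupled squared overlap
vanishes for any fixed perturbation `t > 0`. -/
theorem stmt_8 (β t : ℝ) (ht0 : 0 < t) (ht1 : t ≤ 1) :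
    Tendsto (fun n : ℕ =>
      ∫ p, avg2c β p.1 (skPerturb t p.1 p.2) (fun σ1 σ2 => (overlap σ1 σ2) ^ 2) ∂(skPair n))
      atTop (nhds 0) := by
  simp only [integral_avg2c_skPerturb _ β ht1]
  refine tendsto_overlapMoment (Real.sqrt_nonneg _) ?_
  rw [Real.sqrt_lt' one_pos]
  linarith
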